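/- Let G=(V,E) be a finite simple undirected graph on n ≥ 2 vertices in which every vertex has positive degree, let W be its lazy random walk transition matrix, let α ∈ (0,1), and let s = χ_u be the indicator vector of a vertex u ∈ V. Let T be an integer with (10 ln n)/α ≤ T ≤ (20 ln n)/α, let η be a real number with η ≥ 3 n^{-10}, and suppose that for each i ∈ {1,…,T} a vector q̃_i ∈ ℝ^V satisfies |q̃_i(v) − (s W^i)(v)| ≤ η α/(100 ln n) + n^{-10} for every v ∈ V. Then the vector q̃ := α s + α Σ_{i=1}^{T} (1−α)^i q̃_i is an η-additive approximation of pr_α(s), i.e. |q̃(v) − pr_α(s)(v)| ≤ η for every v ∈ V. -/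

import Mathlib

open Matrix Finset

/-- The lazy random walk transition matrix `W = (1/2)(I + D⁻¹A)` of a simple graph,
acting on row vectors. -/
noncomputable def lazyWalk {V : Type*} [Fintype V] [DecidableEq V] (G : SimpleGraph V)
    [DecidableRel G.Adj] : Matrix V V ℝ :=
  fun u v => (if u = v then (1 : ℝ) / 2 else 0) +
    (if G.Adj u v then 1 / (2 * (G.degree u : ℝ)) else 0)

theorem sum_abs_lazyWalk {V : Type*} [Fintype V] [DecidableEq V] (G : SimpleGraph V)
    [DecidableRel G.Adj] (u : V) (hdeg : 0 < G.degree u) :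
    ∑ v, |lazyWalk G u v| = 1 := by
  have hd : (0 : ℝ) < G.degree u := by exact_mod_cast hdeg
  have hnonneg : ∀ v, 0 ≤ lazyWalk G u v := fun v => by
    unfold lazyWalk
    split_ifs <;> positivity
  simp_rw [abs_of_nonneg (hnonneg _)]
  simp only [lazyWalk, Finset.sum_add_distrib, Finset.sum_ite_eq, Finset.mem_univ, if_true]
  rw [← Finset.sum_filter, Finset.sum_const, ← G.neighborFinset_eq_filter,
    G.card_neighborFinset_eq_degree, nsmul_eq_mul]
  field_simp
  norm_num

/-- The lazy walk does not increase the `ℓ¹` norm. -/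
theorem sum_abs_vecMul_lazyWalk_le {V : Type*} [Fintype V] [DecidableEq V] (G : SimpleGraph V)
    [DecidableRel G.Adj] (hdeg : ∀ v, 0 < G.degree v) (x : V → ℝ) :
    ∑ v, |(x ᵥ* lazyWalk G) v| ≤ ∑ v, |x v| := by
  calc ∑ v, |(x ᵥ* lazyWalk G) v|
      ≤ ∑ v, ∑ w, |x w| * |lazyWalk G w v| := Finset.sum_le_sum fun v _ => by
        simp_rw [← abs_mul]
        exact Finset.abs_sum_le_sum_abs _ _
    _ = ∑ w, |x w| := by
        rw [Finset.sum_comm]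
        refine Finset.sum_congr rfl fun w _ => ?_
        rw [← Finset.mul_sum, sum_abs_lazyWalk G w (hdeg w), mul_one]

theorem sum_abs_vecMul_lazyWalk_pow_le {V : Type*} [Fintype V] [DecidableEq V]
    (G : SimpleGraph V) [DecidableRel G.Adj] (hdeg : ∀ v, 0 < G.degree v) (x : V → ℝ) (k : ℕ) :
    ∑ v, |(x ᵥ* lazyWalk G ^ k) v| ≤ ∑ v, |x v| := by
  induction k with
  | zero => simp
  | succ k ih =>
    rw [pow_succ, ← Matrix.vecMul_vecMul]
    exact (sum_abs_vecMul_lazyWalk_le G hdeg _).trans ih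

/-- Unrolling the PageRank equation `k + 1` times. -/
theorem pageRank_unroll {V : Type*} [Fintype V] [DecidableEq V] (M : Matrix V V ℝ) (α : ℝ)
    (s p : V → ℝ) (hp : p = α • s + (1 - α) • (p ᵥ* M)) (k : ℕ) :
    p = α • s + α • (∑ i ∈ Finset.Icc 1 k, (1 - α) ^ i • (s ᵥ* M ^ i)) +
      (1 - α) ^ (k + 1) • (p ᵥ* M ^ (k + 1)) := by
  induction k with
  | zero => simpa using hp
  | succ k ih =>
    have hstep : p ᵥ* M ^ (k + 1) =
        α • (s ᵥ* M ^ (k + 1)) + (1 - α) • (p ᵥ* M ^ (k + 1 + 1)) := by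
      conv_lhs => rw [hp]
      rw [Matrix.add_vecMul, Matrix.smul_vecMul, Matrix.smul_vecMul, Matrix.vecMul_vecMul,
        ← pow_succ']
    rw [Finset.sum_Icc_succ_top (by omega)]
    conv_lhs => rw [ih, hstep]
    ext v
    simp only [Pi.add_apply, Pi.smul_apply, smul_eq_mul]
    ring

theorem mul_sum_Icc_one_sub_pow_le_one {α : ℝ} (h0 : 0 ≤ α) (h1 : α ≤ 1) (k : ℕ) :
    α * ∑ i ∈ Finset.Icc 1 k, (1 - α) ^ i ≤ 1 := by
  have key : α * ∑ i ∈ Finset.Icc 1 k, (1 - α) ^ i = (1 - α) - (1 - α) ^ (k + 1) := by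
    induction k with
    | zero => simp
    | succ k ih =>
      rw [Finset.sum_Icc_succ_top (by omega), mul_add, ih]
      ring
  have := pow_nonneg (sub_nonneg.2 h1) (k + 1)
  linarith

theorem one_sub_pow_le_zpow_neg_ten {α x : ℝ} (h0 : 0 < α) (h1 : α < 1) (hx : 0 < x) (k : ℕ)
    (hk : 10 * Real.log x / α ≤ k) : (1 - α) ^ (k + 1) ≤ x ^ (-10 : ℤ) := by
  have hk' : 10 * Real.log x ≤ k * α := (div_le_iff₀ h0).1 hk
  calc (1 - α) ^ (k + 1) ≤ (1 - α) ^ k :=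
        pow_le_pow_of_le_one (by linarith) (by linarith) (by omega)
    _ ≤ Real.exp (-α) ^ k :=
        pow_le_pow_left₀ (by linarith) (Real.one_sub_le_exp_neg α) k
    _ = Real.exp (k * -α) := (Real.exp_nat_mul _ _).symm
    _ ≤ Real.exp (Real.log x * ((-10 : ℤ) : ℝ)) := by
        apply Real.exp_le_exp.2
        push_cast
        linarith
    _ = x ^ (-10 : ℤ) := by
        rw [← Real.rpow_def_of_pos hx, Real.rpow_intCast]

theorem stmt12 {V : Type*} [Fintype V] [DecidableEq V] (G : SimpleGraph V)
    [DecidableRel G.Adj] (hdeg : ∀ v, 0 < G.degree v)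
    (hn : 2 ≤ Fintype.card V)
    (α : ℝ) (hα : 0 < α ∧ α < 1) (u : V)
    (s : V → ℝ) (hs : s = fun v => if v = u then (1 : ℝ) else 0)
    (p : V → ℝ) (hp : p = α • s + (1 - α) • (p ᵥ* lazyWalk G))
    (T : ℕ) (hT1 : 10 * Real.log (Fintype.card V) / α ≤ (T : ℝ))
    (hT2 : (T : ℝ) ≤ 20 * Real.log (Fintype.card V) / α)
    (η : ℝ) (hη : 3 * (Fintype.card V : ℝ) ^ (-10 : ℤ) ≤ η)
    (qt : ℕ → V → ℝ)
    (hqt : ∀ i ∈ Finset.Icc 1 T, ∀ v : V,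
      |qt i v - (s ᵥ* (lazyWalk G) ^ i) v| ≤
        η * α / (100 * Real.log (Fintype.card V)) + (Fintype.card V : ℝ) ^ (-10 : ℤ))
    (q : V → ℝ)
    (hq : q = α • s + α • (∑ i ∈ Finset.Icc 1 T, ((1 - α) ^ i) • qt i)) :
    ∀ v : V, |q v - p v| ≤ η := by
  intro v
  obtain ⟨h0, h1⟩ := hα
  have hn2 : (2 : ℝ) ≤ Fintype.card V := by exact_mod_cast hn
  set N : ℝ := (Fintype.card V : ℝ)
  have hlog : (1 : ℝ) / 2 ≤ Real.log N := by
    have := Real.log_two_gt_d9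
    have := Real.log_le_log (by norm_num) hn2
    linarith
  have hNpos : 0 < N ^ (-10 : ℤ) := by positivity
  have hη0 : 0 < η := by linarith
  set ε := η * α / (100 * Real.log N) + N ^ (-10 : ℤ) with hε
  have hε0 : 0 ≤ ε := by positivity
  have hεη : ε ≤ η / 50 + η / 3 := by
    have : η * α / (100 * Real.log N) ≤ η / 50 := by
      rw [div_le_div_iff₀ (by positivity) (by norm_num)]
      nlinarith
    linarith
  have hp1 : ∑ w, |p w| ≤ 1 := by
    have hs1 : ∑ w, |s w| = 1 := by simp [hs, apply_ite abs]
    have hle : ∑ w, |p w| ≤ α * ∑ w, |s w| + (1 - α) * ∑ w, |(p ᵥ* lazyWalk G) w| := by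
      rw [Finset.mul_sum, Finset.mul_sum, ← Finset.sum_add_distrib]
      refine Finset.sum_le_sum fun w _ => ?_
      conv_lhs => rw [hp]
      refine (abs_add_le _ _).trans_eq ?_
      simp [abs_mul, abs_of_pos h0, abs_of_pos (sub_pos.2 h1)]
    have := mul_le_mul_of_nonneg_left (sum_abs_vecMul_lazyWalk_le G hdeg p) (sub_pos.2 h1).le
    rw [hs1] at hle
    nlinarith
  have htail : |(p ᵥ* lazyWalk G ^ (T + 1)) v| ≤ 1 :=
    (Finset.single_le_sum (f := fun w => |(p ᵥ* lazyWalk G ^ (T + 1)) w|)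
      (fun _ _ => abs_nonneg _) (Finset.mem_univ v)).trans
      ((sum_abs_vecMul_lazyWalk_pow_le G hdeg p (T + 1)).trans hp1)
  have hdiff : q v - p v =
      α * ∑ i ∈ Finset.Icc 1 T, (1 - α) ^ i * (qt i v - (s ᵥ* lazyWalk G ^ i) v) -
        (1 - α) ^ (T + 1) * (p ᵥ* lazyWalk G ^ (T + 1)) v := by
    have hpv := congrFun (pageRank_unroll (lazyWalk G) α s p hp T) v
    rw [hpv, hq]
    simp only [Pi.add_apply, Pi.smul_apply, Finset.sum_apply, smul_eq_mul, mul_sub,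
      Finset.sum_sub_distrib]
    ring
  have hmain : |α * ∑ i ∈ Finset.Icc 1 T, (1 - α) ^ i * (qt i v - (s ᵥ* lazyWalk G ^ i) v)|
      ≤ ε := by
    rw [abs_mul, abs_of_pos h0]
    calc α * |∑ i ∈ Finset.Icc 1 T, (1 - α) ^ i * (qt i v - (s ᵥ* lazyWalk G ^ i) v)|
        ≤ α * ∑ i ∈ Finset.Icc 1 T, (1 - α) ^ i * ε := by
          refine mul_le_mul_of_nonneg_left ?_ h0.le
          refine (Finset.abs_sum_le_sum_abs _ _).trans (Finset.sum_le_sum fun i hi => ?_)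
          have hpow : 0 ≤ (1 - α) ^ i := pow_nonneg (sub_pos.2 h1).le i
          rw [abs_mul, abs_of_nonneg hpow]
          exact mul_le_mul_of_nonneg_left (hqt i hi v) hpow
      _ = (α * ∑ i ∈ Finset.Icc 1 T, (1 - α) ^ i) * ε := by rw [← Finset.sum_mul, mul_assoc]
      _ ≤ ε := mul_le_of_le_one_left hε0 (mul_sum_Icc_one_sub_pow_le_one h0.le h1.le T)
  have hrest : |(1 - α) ^ (T + 1) * (p ᵥ* lazyWalk G ^ (T + 1)) v| ≤ N ^ (-10 : ℤ) := by
    have hpow : 0 ≤ (1 - α) ^ (T + 1) := pow_nonneg (sub_pos.2 h1).le _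
    rw [abs_mul, abs_of_nonneg hpow]
    exact (mul_le_of_le_one_right hpow htail).trans
      (one_sub_pow_le_zpow_neg_ten h0 h1 (by linarith) T hT1)
  rw [hdiff]
  refine (abs_sub _ _).trans ?_
  linarith
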